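/- arXiv:2504.15980 — 9 statements merged into one kernel-verified Lean document; each statement's English description precedes it below -/
import Mathlib

section
/- Let n ≥ 3 and m ≥ 1. Let H be a normalized Butson matrix BH(m,n), let C be its core with rows c_1,…,c_{n−1}, and let H′ be the (n−1)×n matrix obtained from H by deleting the first row. Let L^(1),…,L^(n−2) be a complete set of LSESC of order n−1 (on symbols {1,…,n−1}). Define the n(n−1)×n(n−1) matrix M as the vertical stack of B_0 and B, where: B_0 = H′ ⊗ J_{n−1} with J_{n−1} the 1×(n−1) all-ones row vector (so B_0 has n−1 rows, row t being each entry H′_{t,j} repeated n−1 times consecutively for j = 1,…,n); and B has (n−1)² rows indexed by pairs (k,t) with 0 ≤ k ≤ n−2 and 1 ≤ t ≤ n−1, the row (k,t) being the concatenation of n blocks of length n−1: block 0 equals c_{k+1}, and block j (for 1 ≤ j ≤ n−1) equals c_{a(k,t,j)}, where a(0,t,j) = t and a(k,t,j) = L^(k)_{t,j} for k ≥ 1. Then M is a Butson matrix BH(m, n(n−1)): all its entries are m-th roots of unity and M·M* = n(n−1)·I_{n(n−1)}. -/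
open Finset in
theorem scarpis_aux (m N : ℕ)
    (H : Matrix (Fin (N+1)) (Fin (N+1)) ℂ)
    (hroots : ∀ i j, H i j ^ m = 1)
    (hortho : H * H.conjTranspose = ((N+1 : ℕ) : ℂ) • 1)
    (hrow1 : ∀ j, H 0 j = 1)
    (hcol1 : ∀ i, H i 0 = 1)
    (C : Matrix (Fin N) (Fin N) ℂ)
    (hC : ∀ i j : Fin N, C i j = H i.succ j.succ)
    (a : Fin N → Fin N → Fin N → Fin N)
    (hsame : ∀ k t t' j, t ≠ t' → a k t j ≠ a k t' j)
    (hdiff : ∀ k k', k ≠ k' → ∀ t t', ∃! j, a k t j = a k' t' j)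
    (M : Matrix (Fin N ⊕ Fin N × Fin N) (Fin (N+1) × Fin N) ℂ)
    (hB0 : ∀ (t : Fin N) (j : Fin (N+1)) (u : Fin N),
      M (Sum.inl t) (j, u) = H t.succ j)
    (hBblk0 : ∀ (k t u : Fin N), M (Sum.inr (k, t)) (0, u) = C k u)
    (hBblk : ∀ (k t j u : Fin N), M (Sum.inr (k, t)) (j.succ, u) = C (a k t j) u) :
    (∀ r c, M r c ^ m = 1) ∧
      M * M.conjTranspose = (((N+1) * N : ℕ) : ℂ) • 1 := by
  have hH : ∀ i i', ∑ j, H i j * star (H i' j) = if i = i' then (N+1 : ℂ) else 0 := by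
    intro i i'
    have := congrFun (congrFun hortho i) i'
    simpa [Matrix.mul_apply, Matrix.one_apply] using this
  have hsum : ∀ i : Fin N, ∑ j, H i.succ j = 0 := by
    intro i
    have := hH i.succ 0
    simpa [hrow1, Fin.succ_ne_zero] using this
  have hCsum : ∀ i : Fin N, ∑ j, C i j = -1 := by
    intro i
    have := hsum i
    rw [Fin.sum_univ_succ, hcol1] at this
    simp only [hC]
    linear_combination this
  have hCC : ∀ i i' : Fin N, ∑ j, C i j * star (C i' j)
      = (if i = i' then (N+1 : ℂ) else 0) - 1 := by
    intro i i'
    have := hH i.succ i'.succ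
    rw [Fin.sum_univ_succ, hcol1, hcol1] at this
    simp only [hC]
    simp only [Fin.succ_inj, star_one] at this
    linear_combination this
  have hcount : ∀ k k' t t', ∑ j, (if a k t j = a k' t' j then (N+1 : ℂ) else 0)
      = if k = k' then (if t = t' then (N+1 : ℂ) * N else 0) else (N+1 : ℂ) := by
    intro k k' t t'
    split_ifs with h1 h2
    · subst h1 h2; simp; ring
    · subst h1; simp [hsame _ _ _ _ h2]
    · obtain ⟨j0, hj0, hu⟩ := hdiff k k' h1 t t'
      rw [Finset.sum_eq_single j0]
      · simp [hj0]
      · intro b _ hb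
        rw [if_neg]
        exact fun h => hb (hu b h)
      · simp
  have hBrow : ∀ k t j, ∑ u, M (Sum.inr (k, t)) (j, u) = -1 := by
    intro k t j
    refine Fin.cases ?_ (fun j => ?_) j
    · simp only [hBblk0, hCsum]
    · simp only [hBblk, hCsum]
  have hcross : ∀ s k t, ∑ j, ∑ u, M (Sum.inl s) (j, u) * star (M (Sum.inr (k, t)) (j, u)) = 0 := by
    intro s k t
    have : ∀ j, ∑ u, M (Sum.inl s) (j, u) * star (M (Sum.inr (k, t)) (j, u)) = - H s.succ j := by
      intro j
      simp only [hB0]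
      rw [← Finset.mul_sum, ← star_sum, hBrow]
      simp
    simp only [this, Finset.sum_neg_distrib, hsum, neg_zero]
  constructor
  · rintro (t | ⟨k, t⟩) ⟨j, u⟩
    · rw [hB0, hroots]
    · refine Fin.cases ?_ (fun j => ?_) j
      · rw [hBblk0, hC, hroots]
      · rw [hBblk, hC, hroots]
  · ext r r'
    rw [Matrix.mul_apply, Fintype.sum_prod_type]
    simp only [Matrix.conjTranspose_apply, Matrix.smul_apply, Matrix.one_apply, smul_eq_mul]
    rcases r with s | ⟨k, t⟩ <;> rcases r' with s' | ⟨k', t'⟩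
    · simp only [hB0, Finset.sum_const, Finset.card_univ, Fintype.card_fin, nsmul_eq_mul]
      rw [← Finset.mul_sum, hH]
      by_cases h : s = s'
      · simp [h, mul_comm]
      · simp [h]
    · rw [hcross]; simp
    · have := congrArg star (hcross s' k t)
      simp only [star_sum, star_mul, star_star, star_zero] at this
      rw [this]; simp
    · rw [Fin.sum_univ_succ]
      simp only [hBblk0, hBblk, hCC, Finset.sum_sub_distrib, hcount]
      by_cases h : k = k'
      · by_cases h' : t = t'
        · simp [h, h']
        · simp [h, h']
      · simp [h]

/-- Theorem 1, construction of `BH(m,(n-1)n)` from `BH(m,n)`.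
`H` is a normalized Butson matrix `BH(m,n)` with core `C` (rows `c_1,…,c_{n-1}`,
0-indexed here as `C 0,…,C (n-2)`), and `Ls` is a complete set of `n-2` pairwise
LSESC Latin squares of order `n-1` (rows, columns and symbols indexed by
`Fin (n-1)`).  The matrix `M` is the vertical stack of
`B_0 = H' ⊗ J_{n-1}` (rows indexed by `Fin (n-1)`, `H'` being `H` without its
first row) and `B` (rows indexed by pairs `(k,t)`), whose columns come in `n`
blocks of width `n-1` (block `j`, position `u` encoded as the column index
`(j,u) : Fin n × Fin (n-1)`): block `0` of row `(k,t)` is the core row `c_{k+1}`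
and block `j ≥ 1` is `c_{a(k,t,j)}`, where `a(0,t,j) = t` and
`a(k,t,j) = L^(k)_{t,j}` for `k ≥ 1`.  Then `M` is a Butson matrix
`BH(m, n(n-1))`: all its entries are `m`-th roots of unity and
`M·M* = n(n-1)·I`. -/
theorem butson_scarpis_construction (m n : ℕ) (hm : 1 ≤ m) (hn : 3 ≤ n)
    (H : Matrix (Fin n) (Fin n) ℂ)
    (hroots : ∀ i j, H i j ^ m = 1)
    (hortho : H * H.conjTranspose = (n : ℂ) • 1)
    (hrow1 : ∀ j, H ⟨0, by omega⟩ j = 1)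
    (hcol1 : ∀ i, H i ⟨0, by omega⟩ = 1)
    -- the core of `H`
    (C : Matrix (Fin (n - 1)) (Fin (n - 1)) ℂ)
    (hC : ∀ i j : Fin (n - 1), C i j = H ⟨(i : ℕ) + 1, by omega⟩ ⟨(j : ℕ) + 1, by omega⟩)
    -- a complete set of LSESC of order `n-1`
    (Ls : Fin (n - 2) → Matrix (Fin (n - 1)) (Fin (n - 1)) (Fin (n - 1)))
    (hLatinRow : ∀ k i, Function.Bijective (fun j => Ls k i j))
    (hLatinCol : ∀ k j, Function.Bijective (fun i => Ls k i j))
    (hLSESC : ∀ k k', k ≠ k' → ∀ i i', ∃! j, Ls k i j = Ls k' i' j)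
    -- the row-indexing function `a`
    (a : Fin (n - 1) → Fin (n - 1) → Fin (n - 1) → Fin (n - 1))
    (ha0 : ∀ t j, a ⟨0, by omega⟩ t j = t)
    (hak : ∀ (k : Fin (n - 1)) (hk : (k : ℕ) ≠ 0) (t j : Fin (n - 1)),
      a k t j = Ls ⟨(k : ℕ) - 1, by omega⟩ t j)
    -- the matrix `M`: vertical stack of `B_0` and `B`
    (M : Matrix (Fin (n - 1) ⊕ Fin (n - 1) × Fin (n - 1)) (Fin n × Fin (n - 1)) ℂ)
    (hB0 : ∀ (t : Fin (n - 1)) (j : Fin n) (u : Fin (n - 1)),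
      M (Sum.inl t) (j, u) = H ⟨(t : ℕ) + 1, by omega⟩ j)
    (hBblk0 : ∀ (k t : Fin (n - 1)) (u : Fin (n - 1)),
      M (Sum.inr (k, t)) (⟨0, by omega⟩, u) = C k u)
    (hBblk : ∀ (k t : Fin (n - 1)) (j : Fin n) (hj : (j : ℕ) ≠ 0) (u : Fin (n - 1)),
      M (Sum.inr (k, t)) (j, u) = C (a k t ⟨(j : ℕ) - 1, by omega⟩) u) :
    (∀ r c, M r c ^ m = 1) ∧
      M * M.conjTranspose = ((n * (n - 1) : ℕ) : ℂ) • 1 := by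
  obtain ⟨N, rfl⟩ : ∃ N, n = N + 1 := ⟨n - 1, by omega⟩
  have ha0' : ∀ k : Fin (N + 1 - 1), (k : ℕ) = 0 → ∀ t j, a k t j = t := by
    rintro ⟨k, hk⟩ h t j
    simp only at h
    subst h
    exact ha0 t j
  have hsame : ∀ k t t' j, t ≠ t' → a k t j ≠ a k t' j := by
    intro k t t' j hne h
    by_cases hk : (k : ℕ) = 0
    · rw [ha0' k hk, ha0' k hk] at h
      exact hne h
    · rw [hak k hk, hak k hk] at h
      exact hne ((hLatinCol _ j).1 h)
  have hdiff : ∀ k k', k ≠ k' → ∀ t t', ∃! j, a k t j = a k' t' j := by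
    intro k k' hne t t'
    by_cases hk : (k : ℕ) = 0
    · have hk' : (k' : ℕ) ≠ 0 := fun h => hne (Fin.ext (hk.trans h.symm))
      simp only [ha0' k hk, hak k' hk']
      simpa only [eq_comm] using (hLatinRow ⟨(k' : ℕ) - 1, by omega⟩ t').existsUnique t
    · by_cases hk' : (k' : ℕ) = 0
      · simp only [ha0' k' hk', hak k hk]
        exact (hLatinRow ⟨(k : ℕ) - 1, by omega⟩ t).existsUnique t'
      · simp only [hak k hk, hak k' hk']
        apply hLSESC
        intro h
        apply hne
        have := congrArg Fin.val h
        simp only at this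
        exact Fin.ext (by omega)
  exact scarpis_aux m N H hroots hortho hrow1 hcol1 C hC a hsame hdiff M hB0 hBblk0
    (fun k t j u => hBblk k t j.succ (by simp) u)
end

section
/- Let n ≥ 3 and m ≥ 1. Let G and H be normalized Butson matrices BH(m,n), let C be the core of H with rows c_1,…,c_{n−1}, and let G′ be the (n−1)×n matrix obtained from G by deleting the first row. Let L^(1),…,L^(n−2) be a complete set of LSESC of order n−1. Define the n(n−1)×n(n−1) matrix M as the vertical stack of B_0 and B, where: B_0 = G′ ⊗ J_{n−1} with J_{n−1} the 1×(n−1) all-ones row vector; and B has (n−1)² rows indexed by pairs (k,t) with 0 ≤ k ≤ n−2 and 1 ≤ t ≤ n−1, the row (k,t) being the concatenation of n blocks of length n−1: block 0 equals c_{k+1}, and block j (for 1 ≤ j ≤ n−1) equals c_{a(k,t,j)}, where a(0,t,j) = t and a(k,t,j) = L^(k)_{t,j} for k ≥ 1. Then M is a Butson matrix BH(m, n(n−1)): all its entries are m-th roots of unity and M·M* = n(n−1)·I_{n(n−1)}. -/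
theorem butson_scarpis_aux (m N : ℕ)
    (G H : Matrix (Fin (N + 1)) (Fin (N + 1)) ℂ)
    (hGroots : ∀ i j, G i j ^ m = 1)
    (hGortho : G * G.conjTranspose = ((N + 1 : ℕ) : ℂ) • 1)
    (hGrow1 : ∀ j, G 0 j = 1)
    (hHroots : ∀ i j, H i j ^ m = 1)
    (hHortho : H * H.conjTranspose = ((N + 1 : ℕ) : ℂ) • 1)
    (hHrow1 : ∀ j, H 0 j = 1)
    (hHcol1 : ∀ i, H i 0 = 1)
    (C : Matrix (Fin N) (Fin N) ℂ)
    (hC : ∀ i j : Fin N, C i j = H i.succ j.succ)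
    (a : Fin N → Fin N → Fin N → Fin N)
    (h1 : ∀ k t t', t ≠ t' → ∀ j, a k t j ≠ a k t' j)
    (h2 : ∀ k k', k ≠ k' → ∀ t t', ∃! j, a k t j = a k' t' j)
    (M : Matrix (Fin N ⊕ Fin N × Fin N) (Fin (N + 1) × Fin N) ℂ)
    (hB0 : ∀ (t : Fin N) (j : Fin (N + 1)) (u : Fin N), M (Sum.inl t) (j, u) = G t.succ j)
    (hBblk0 : ∀ k t u, M (Sum.inr (k, t)) (0, u) = C k u)
    (hBblk : ∀ k t (j : Fin N) u, M (Sum.inr (k, t)) (j.succ, u) = C (a k t j) u) :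
    (∀ r c, M r c ^ m = 1) ∧
      M * M.conjTranspose = (((N + 1) * N : ℕ) : ℂ) • 1 := by
  have hG : ∀ i i', ∑ j, G i j * star (G i' j) = if i = i' then ((N : ℂ) + 1) else 0 := by
    intro i i'
    have := congrFun (congrFun hGortho i) i'
    simpa [Matrix.mul_apply, Matrix.one_apply] using this
  have hH : ∀ i i', ∑ j, H i j * star (H i' j) = if i = i' then ((N : ℂ) + 1) else 0 := by
    intro i i'
    have := congrFun (congrFun hHortho i) i'
    simpa [Matrix.mul_apply, Matrix.one_apply] using this
  have hGs : ∀ t : Fin N, ∑ j, G t.succ j = 0 := by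
    intro t
    have := hG t.succ 0
    simpa [hGrow1, Fin.succ_ne_zero] using this
  have hCs : ∀ i : Fin N, ∑ u, C i u = -1 := by
    intro i
    have := hH i.succ 0
    simp only [hHrow1, Fin.succ_ne_zero, star_one, mul_one, if_false, Fin.sum_univ_succ, hHcol1,
      ← hC] at this
    linear_combination this
  have hCC : ∀ i i' : Fin N, ∑ u, C i u * star (C i' u)
      = ((N : ℂ) + 1) * (if i = i' then 1 else 0) - 1 := by
    intro i i'
    have := hH i.succ i'.succ
    simp only [Fin.succ_inj, star_one, mul_one, Fin.sum_univ_succ, hHcol1, ← hC] at this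
    rw [mul_ite, mul_one, mul_zero, ← this]
    ring
  have hlr : ∀ t k s, ∑ c, M (Sum.inl t) c * star (M (Sum.inr (k, s)) c) = 0 := by
    intro t k s
    rw [Fintype.sum_prod_type]
    have hin : ∀ j, ∑ u, M (Sum.inl t) (j, u) * star (M (Sum.inr (k, s)) (j, u))
        = - G t.succ j := by
      intro j
      simp only [hB0, ← Finset.mul_sum, ← star_sum]
      have : ∑ u, M (Sum.inr (k, s)) (j, u) = -1 := by
        refine Fin.cases ?_ (fun j => ?_) j
        · simp only [hBblk0, hCs]
        · simp only [hBblk, hCs]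
      rw [this]; simp
    simp only [hin, Finset.sum_neg_distrib, hGs, neg_zero]
  refine ⟨?_, ?_⟩
  · rintro (t | ⟨k, t⟩) ⟨j, u⟩
    · rw [hB0, hGroots]
    · refine Fin.cases ?_ (fun j => ?_) j
      · rw [hBblk0, hC, hHroots]
      · rw [hBblk, hC, hHroots]
  · ext r r'
    rw [Matrix.mul_apply, Matrix.smul_apply, Matrix.one_apply]
    simp only [Matrix.conjTranspose_apply]
    rcases r with t | ⟨k, t⟩ <;> rcases r' with t' | ⟨k', t'⟩
    · rw [Fintype.sum_prod_type]
      simp only [hB0, Finset.sum_const, Finset.card_univ, Fintype.card_fin, ← Finset.smul_sum, hG,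
        Fin.succ_inj, Sum.inl.injEq]
      split_ifs <;> simp
      ring
    · rw [hlr]; simp
    · have := congrArg star (hlr t' k t)
      simp only [star_sum, star_mul', star_star, star_zero] at this
      simp only [mul_comm (star _)] at this
      rw [this]; simp
    · rw [Fintype.sum_prod_type, Fin.sum_univ_succ]
      simp only [hBblk0, hBblk, hCC, Sum.inr.injEq, Prod.mk.injEq, Finset.sum_sub_distrib,
        ← Finset.mul_sum, Finset.sum_const, Finset.card_univ, Fintype.card_fin]
      by_cases hk : k = k'
      · subst hk
        by_cases ht : t = t'
        · subst ht
          simp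
        · simp [ht, h1 k t t' ht]
      · obtain ⟨j, hj, hu⟩ := h2 k k' hk t t'
        have : ∀ i, (a k t i = a k' t' i) ↔ i = j := fun i => ⟨hu i, fun h => h ▸ hj⟩
        simp [hk, this]

/-- Corollary 1, two-input construction of `BH(m,(n-1)n)`.
`G` and `H` are normalized Butson matrices `BH(m,n)`, `C` is the core of `H`
(rows 0-indexed), and `Ls` is a complete set of `n-2` pairwise LSESC Latin
squares of order `n-1`.  The matrix `M` is the vertical stack of
`B_0 = G' ⊗ J_{n-1}` (`G'` being `G` without its first row, rows indexed by
`Fin (n-1)`) and `B` (rows indexed by pairs `(k,t)`), whose columns come in `n`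
blocks of width `n-1` (block `j`, position `u` encoded as `(j,u)`):
block `0` of row `(k,t)` is the core row `c_{k+1}` and block `j ≥ 1` is
`c_{a(k,t,j)}`, where `a(0,t,j) = t` and `a(k,t,j) = L^(k)_{t,j}` for `k ≥ 1`.
Then `M` is a Butson matrix `BH(m, n(n-1))`. -/
theorem butson_scarpis_construction_two_inputs (m n : ℕ) (hm : 1 ≤ m) (hn : 3 ≤ n)
    (G H : Matrix (Fin n) (Fin n) ℂ)
    (hGroots : ∀ i j, G i j ^ m = 1)
    (hGortho : G * G.conjTranspose = (n : ℂ) • 1)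
    (hGrow1 : ∀ j, G ⟨0, by omega⟩ j = 1)
    (hGcol1 : ∀ i, G i ⟨0, by omega⟩ = 1)
    (hHroots : ∀ i j, H i j ^ m = 1)
    (hHortho : H * H.conjTranspose = (n : ℂ) • 1)
    (hHrow1 : ∀ j, H ⟨0, by omega⟩ j = 1)
    (hHcol1 : ∀ i, H i ⟨0, by omega⟩ = 1)
    -- the core of `H`
    (C : Matrix (Fin (n - 1)) (Fin (n - 1)) ℂ)
    (hC : ∀ i j : Fin (n - 1), C i j = H ⟨(i : ℕ) + 1, by omega⟩ ⟨(j : ℕ) + 1, by omega⟩)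
    -- a complete set of LSESC of order `n-1`
    (Ls : Fin (n - 2) → Matrix (Fin (n - 1)) (Fin (n - 1)) (Fin (n - 1)))
    (hLatinRow : ∀ k i, Function.Bijective (fun j => Ls k i j))
    (hLatinCol : ∀ k j, Function.Bijective (fun i => Ls k i j))
    (hLSESC : ∀ k k', k ≠ k' → ∀ i i', ∃! j, Ls k i j = Ls k' i' j)
    -- the row-indexing function `a`
    (a : Fin (n - 1) → Fin (n - 1) → Fin (n - 1) → Fin (n - 1))
    (ha0 : ∀ t j, a ⟨0, by omega⟩ t j = t)
    (hak : ∀ (k : Fin (n - 1)) (hk : (k : ℕ) ≠ 0) (t j : Fin (n - 1)),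
      a k t j = Ls ⟨(k : ℕ) - 1, by omega⟩ t j)
    -- the matrix `M`: vertical stack of `B_0` and `B`
    (M : Matrix (Fin (n - 1) ⊕ Fin (n - 1) × Fin (n - 1)) (Fin n × Fin (n - 1)) ℂ)
    (hB0 : ∀ (t : Fin (n - 1)) (j : Fin n) (u : Fin (n - 1)),
      M (Sum.inl t) (j, u) = G ⟨(t : ℕ) + 1, by omega⟩ j)
    (hBblk0 : ∀ (k t : Fin (n - 1)) (u : Fin (n - 1)),
      M (Sum.inr (k, t)) (⟨0, by omega⟩, u) = C k u)
    (hBblk : ∀ (k t : Fin (n - 1)) (j : Fin n) (hj : (j : ℕ) ≠ 0) (u : Fin (n - 1)),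
      M (Sum.inr (k, t)) (j, u) = C (a k t ⟨(j : ℕ) - 1, by omega⟩) u) :
    (∀ r c, M r c ^ m = 1) ∧
      M * M.conjTranspose = ((n * (n - 1) : ℕ) : ℂ) • 1 := by
  obtain ⟨K, rfl⟩ : ∃ K, n = K + 2 := ⟨n - 2, by omega⟩
  have ha0' : ∀ k : Fin (K + 2 - 1), (k : ℕ) = 0 → ∀ t j, a k t j = t := by
    rintro ⟨k, hlt⟩ hk t j
    simp only at hk
    subst hk
    exact ha0 t j
  have h1 : ∀ k t t', t ≠ t' → ∀ j, a k t j ≠ a k t' j := by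
    intro k t t' htt j h
    by_cases hk : (k : ℕ) = 0
    · rw [ha0' k hk, ha0' k hk] at h
      exact htt h
    · rw [hak k hk, hak k hk] at h
      exact htt ((hLatinCol _ j).1 h)
  have h2 : ∀ k k', k ≠ k' → ∀ t t', ∃! j, a k t j = a k' t' j := by
    intro k k' hkk t t'
    by_cases hk : (k : ℕ) = 0
    · have hk' : (k' : ℕ) ≠ 0 := fun h => hkk (Fin.ext (hk.trans h.symm))
      simp only [ha0' k hk, hak k' hk']
      simpa [eq_comm] using (hLatinRow _ t').existsUnique t
    · by_cases hk' : (k' : ℕ) = 0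
      · simp only [ha0' k' hk', hak k hk]
        exact (hLatinRow _ t).existsUnique t'
      · simp only [hak k hk, hak k' hk']
        refine hLSESC _ _ (fun h => hkk (Fin.ext ?_)) t t'
        have := congrArg Fin.val h
        simp only at this
        omega
  exact butson_scarpis_aux m (K + 1) G H hGroots hGortho hGrow1 hHroots hHortho hHrow1 hHcol1 C hC
    a h1 h2 M hB0 hBblk0 (fun k t j u => hBblk k t j.succ (by simp) u)
end

section
/- Let n ≥ 3. Let G and H be normalized Hadamard matrices of order n, let C be the core of H (the (n−1)×(n−1) submatrix of H obtained by deleting the first row and first column) with rows c_1,…,c_{n−1}, and let G′ be the (n−1)×n matrix obtained from G by deleting the first row. Let L^(1),…,L^(n−2) be a complete set of LSESC of order n−1. Define the n(n−1)×n(n−1) matrix M as the vertical stack of B_0 and B, where: B_0 = G′ ⊗ J_{n−1} with J_{n−1} the 1×(n−1) all-ones row vector; and B has (n−1)² rows indexed by pairs (k,t) with 0 ≤ k ≤ n−2 and 1 ≤ t ≤ n−1, the row (k,t) being the concatenation of n blocks of length n−1: block 0 equals c_{k+1}, and block j (for 1 ≤ j ≤ n−1) equals c_{a(k,t,j)}, where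 a(0,t,j) = t and a(k,t,j) = L^(k)_{t,j} for k ≥ 1. Then M is a Hadamard matrix of order n(n−1): all its entries lie in {1,−1} and M·Mᵀ = n(n−1)·I_{n(n−1)}. -/
/-- Shifted form of the construction, with the agreement counts of `a` abstracted. -/
lemma scarpis_core (m : ℕ) (G H : Matrix (Fin (m+1)) (Fin (m+1)) ℝ)
    (hGpm : ∀ i j, G i j = 1 ∨ G i j = -1)
    (hGortho : G * G.transpose = ((m + 1 : ℕ) : ℝ) • 1)
    (hGrow1 : ∀ j, G 0 j = 1)
    (hHpm : ∀ i j, H i j = 1 ∨ H i j = -1)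
    (hHortho : H * H.transpose = ((m + 1 : ℕ) : ℝ) • 1)
    (hHrow1 : ∀ j, H 0 j = 1)
    (hHcol1 : ∀ i, H i 0 = 1)
    (C : Matrix (Fin m) (Fin m) ℝ)
    (hC : ∀ i j : Fin m, C i j = H i.succ j.succ)
    (a : Fin m → Fin m → Fin m → Fin m)
    (hagree : ∀ k t k' t', (∑ j, if a k t j = a k' t' j then (1 : ℝ) else 0) =
      if k = k' then (if t = t' then (m : ℝ) else 0) else 1)
    (M : Matrix (Fin m ⊕ Fin m × Fin m) (Fin (m + 1) × Fin m) ℝ)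
    (hB0 : ∀ (t : Fin m) (j : Fin (m + 1)) (u : Fin m), M (Sum.inl t) (j, u) = G t.succ j)
    (hBblk0 : ∀ (k t : Fin m) (u : Fin m), M (Sum.inr (k, t)) (0, u) = C k u)
    (hBblk : ∀ (k t : Fin m) (j : Fin m) (u : Fin m),
      M (Sum.inr (k, t)) (j.succ, u) = C (a k t j) u) :
    (∀ r c, M r c = 1 ∨ M r c = -1) ∧
      M * M.transpose = (((m + 1) * m : ℕ) : ℝ) • 1 := by
  have hG : ∀ i i', ∑ j, G i j * G i' j = if i = i' then (m : ℝ) + 1 else 0 := by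
    intro i i'
    have := congrFun (congrFun hGortho i) i'
    simpa [Matrix.mul_apply, Matrix.one_apply] using this
  have hH : ∀ i i', ∑ j, H i j * H i' j = if i = i' then (m : ℝ) + 1 else 0 := by
    intro i i'
    have := congrFun (congrFun hHortho i) i'
    simpa [Matrix.mul_apply, Matrix.one_apply] using this
  have hGs : ∀ t : Fin m, ∑ j, G t.succ j = 0 := by
    intro t
    have := hG t.succ 0
    simpa [hGrow1, Fin.succ_ne_zero] using this
  have hCs : ∀ i, ∑ u, C i u = -1 := by
    intro i
    have := hH i.succ 0
    rw [Fin.sum_univ_succ] at this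
    simp [hHrow1, hHcol1, Fin.succ_ne_zero, ← hC] at this
    linarith
  have hD : ∀ i i', ∑ u, C i u * C i' u = ((m : ℝ) + 1) * (if i = i' then 1 else 0) - 1 := by
    intro i i'
    have := hH i.succ i'.succ
    rw [Fin.sum_univ_succ] at this
    simp only [hHcol1, ← hC, Fin.succ_inj] at this
    split_ifs at this ⊢ <;> linarith
  have hrow : ∀ k t j, ∑ u, M (Sum.inr (k, t)) (j, u) = -1 := by
    intro k t j
    induction j using Fin.cases with
    | zero => simp only [hBblk0, hCs]
    | succ j => simp only [hBblk, hCs]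
  refine ⟨?_, ?_⟩
  · rintro (t | ⟨k, t⟩) ⟨j, u⟩
    · rw [hB0]; exact hGpm _ _
    · induction j using Fin.cases with
      | zero => rw [hBblk0, hC]; exact hHpm _ _
      | succ j => rw [hBblk, hC]; exact hHpm _ _
  · have hmix : ∀ t k t', ∑ x : Fin (m + 1) × Fin m, M (Sum.inl t) x * M (Sum.inr (k, t')) x = 0 := by
      intro t k t'
      rw [Fintype.sum_prod_type]
      simp only [hB0, ← Finset.mul_sum, hrow, mul_neg, mul_one, Finset.sum_neg_distrib, hGs, neg_zero]
    ext r s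
    rw [Matrix.mul_apply]
    simp only [Matrix.transpose_apply, Matrix.smul_apply, Matrix.one_apply, smul_eq_mul]
    rcases r with t | ⟨k, t⟩ <;> rcases s with t' | ⟨k', t'⟩
    · rw [Fintype.sum_prod_type]
      simp only [hB0, Finset.sum_const, Finset.card_univ, Fintype.card_fin, nsmul_eq_mul,
        ← Finset.mul_sum, hG, Fin.succ_inj, Sum.inl.injEq]
      push_cast
      split_ifs <;> ring
    · rw [hmix]; simp
    · simp only [mul_comm (M (Sum.inr _) _)]
      rw [hmix]; simp
    · rw [Fintype.sum_prod_type, Fin.sum_univ_succ]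
      simp only [hBblk0, hBblk, hD, Finset.sum_sub_distrib, ← Finset.mul_sum, hagree,
        Finset.sum_const, Finset.card_univ, Fintype.card_fin, nsmul_eq_mul, Sum.inr.injEq,
        Prod.mk.injEq]
      push_cast
      by_cases h1 : k = k' <;> by_cases h2 : t = t' <;> simp [h1, h2] <;> ring

/-- Corollary 2, two-input Scarpis construction of Hadamard matrices of
order `n(n-1)`.  `G` and `H` are normalized Hadamard matrices of order `n`, `C` is
the core of `H` (rows 0-indexed), and `Ls` is a complete set of `n-2` pairwise LSESC
Latin squares of order `n-1`.  The matrix `M` is the vertical stack of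
`B_0 = G' ⊗ J_{n-1}` (`G'` being `G` without its first row) and `B` (rows indexed by
pairs `(k,t)`), whose columns come in `n` blocks of width `n-1` (block `j`, position
`u` encoded as `(j,u)`): block `0` of row `(k,t)` is the core row `c_{k+1}` and block
`j ≥ 1` is `c_{a(k,t,j)}`, where `a(0,t,j) = t` and `a(k,t,j) = L^(k)_{t,j}` for
`k ≥ 1`.  Then `M` is a Hadamard matrix of order `n(n-1)`: its entries lie in
`{1,-1}` and `M·Mᵀ = n(n-1)·I`. -/
theorem hadamard_scarpis_construction_two_inputs (n : ℕ) (hn : 3 ≤ n)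
    (G H : Matrix (Fin n) (Fin n) ℝ)
    (hGpm : ∀ i j, G i j = 1 ∨ G i j = -1)
    (hGortho : G * G.transpose = (n : ℝ) • 1)
    (hGrow1 : ∀ j, G ⟨0, by omega⟩ j = 1)
    (hGcol1 : ∀ i, G i ⟨0, by omega⟩ = 1)
    (hHpm : ∀ i j, H i j = 1 ∨ H i j = -1)
    (hHortho : H * H.transpose = (n : ℝ) • 1)
    (hHrow1 : ∀ j, H ⟨0, by omega⟩ j = 1)
    (hHcol1 : ∀ i, H i ⟨0, by omega⟩ = 1)
    -- the core of `H`
    (C : Matrix (Fin (n - 1)) (Fin (n - 1)) ℝ)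
    (hC : ∀ i j : Fin (n - 1), C i j = H ⟨(i : ℕ) + 1, by omega⟩ ⟨(j : ℕ) + 1, by omega⟩)
    -- a complete set of LSESC of order `n-1`
    (Ls : Fin (n - 2) → Matrix (Fin (n - 1)) (Fin (n - 1)) (Fin (n - 1)))
    (hLatinRow : ∀ k i, Function.Bijective (fun j => Ls k i j))
    (hLatinCol : ∀ k j, Function.Bijective (fun i => Ls k i j))
    (hLSESC : ∀ k k', k ≠ k' → ∀ i i', ∃! j, Ls k i j = Ls k' i' j)
    -- the row-indexing function `a`
    (a : Fin (n - 1) → Fin (n - 1) → Fin (n - 1) → Fin (n - 1))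
    (ha0 : ∀ t j, a ⟨0, by omega⟩ t j = t)
    (hak : ∀ (k : Fin (n - 1)) (hk : (k : ℕ) ≠ 0) (t j : Fin (n - 1)),
      a k t j = Ls ⟨(k : ℕ) - 1, by omega⟩ t j)
    -- the matrix `M`: vertical stack of `B_0` and `B`
    (M : Matrix (Fin (n - 1) ⊕ Fin (n - 1) × Fin (n - 1)) (Fin n × Fin (n - 1)) ℝ)
    (hB0 : ∀ (t : Fin (n - 1)) (j : Fin n) (u : Fin (n - 1)),
      M (Sum.inl t) (j, u) = G ⟨(t : ℕ) + 1, by omega⟩ j)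
    (hBblk0 : ∀ (k t : Fin (n - 1)) (u : Fin (n - 1)),
      M (Sum.inr (k, t)) (⟨0, by omega⟩, u) = C k u)
    (hBblk : ∀ (k t : Fin (n - 1)) (j : Fin n) (hj : (j : ℕ) ≠ 0) (u : Fin (n - 1)),
      M (Sum.inr (k, t)) (j, u) = C (a k t ⟨(j : ℕ) - 1, by omega⟩) u) :
    (∀ r c, M r c = 1 ∨ M r c = -1) ∧
      M * M.transpose = ((n * (n - 1) : ℕ) : ℝ) • 1 := by
  have key : ∀ k t k' t', (∑ j, if a k t j = a k' t' j then (1 : ℝ) else 0) =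
      if k = k' then (if t = t' then ((n - 1 : ℕ) : ℝ) else 0) else 1 := by
    have huniq : ∀ k t k' t', (∃! j, a k t j = a k' t' j) →
        (∑ j, if a k t j = a k' t' j then (1 : ℝ) else 0) = 1 := by
      rintro k t k' t' ⟨j₀, h₀, hu⟩
      rw [Finset.sum_eq_single j₀]
      · exact if_pos h₀
      · intro b _ hb
        exact if_neg fun h => hb (hu b h)
      · simp
    intro k t k' t'
    by_cases hk : k = k'
    · subst hk
      by_cases ht : t = t'
      · subst ht; simp
      · rw [if_pos rfl, if_neg ht]
        refine Finset.sum_eq_zero fun j _ => if_neg fun h => ht ?_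
        by_cases h0 : (k : ℕ) = 0
        · have : k = ⟨0, by omega⟩ := Fin.ext h0
          rw [this, ha0, ha0] at h
          exact h
        · rw [hak k h0, hak k h0] at h
          exact (hLatinCol _ j).1 h
    · rw [if_neg hk]
      apply huniq
      have hk' : (k : ℕ) ≠ k' := fun h => hk (Fin.ext h)
      by_cases h0 : (k : ℕ) = 0
      · have e : k = ⟨0, by omega⟩ := Fin.ext h0
        have h0' : (k' : ℕ) ≠ 0 := by omega
        simp only [e, ha0, hak k' h0']
        obtain ⟨j, hj, hu⟩ := (hLatinRow ⟨(k' : ℕ) - 1, by omega⟩ t').existsUnique t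
        exact ⟨j, hj.symm, fun y hy => hu y hy.symm⟩
      · by_cases h0' : (k' : ℕ) = 0
        · have e : k' = ⟨0, by omega⟩ := Fin.ext h0'
          simp only [e, ha0, hak k h0]
          exact (hLatinRow ⟨(k : ℕ) - 1, by omega⟩ t).existsUnique t'
        · simp only [hak k h0, hak k' h0']
          apply hLSESC
          intro h
          have := congrArg Fin.val h
          simp only at this
          omega
  obtain ⟨m, rfl⟩ : ∃ m, n = m + 1 := ⟨n - 1, by omega⟩
  exact scarpis_core m G H hGpm hGortho hGrow1 hHpm hHortho hHrow1 hHcol1 C hC a key M hB0 hBblk0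
    (fun k t j u => hBblk k t j.succ (Nat.succ_ne_zero _) u)
end

section
/- Let n ≥ 4 be even and m ≥ 1. Let H be a normalized Butson matrix BH(m,n) in arranged C2 form, and let C and D be the associated (n−2)/2 × (n−2) matrices. Then for any two distinct row indices i ≠ i′ of C, the dot product of rows i and i′ of C equals −2, i.e. Σ_{j=1}^{n−2} C_{i j}·conj(C_{i′ j}) = −2; and likewise for any two distinct rows i ≠ i′ of D, Σ_{j=1}^{n−2} D_{i j}·conj(D_{i′ j}) = −2. -/
/-- Lemma 2, parts 1–2 for `C` and `D` separately.  Let `n = 2h+2 ≥ 4`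
be even and let `H` be a normalized Butson matrix `BH(m,n)` in arranged C2 form: its
second row and second column equal `w = (1, -1, 1,…,1, -1,…,-1)` (entry `1`, then
`-1`, then `h` ones, then `h` minus-ones).  Let `C` (resp. `D`) be the first (resp.
last) `h` rows of the `(n-2)×(n-2)` lower-right submatrix `T` of `H`.  Then the dot
product of any two distinct rows of `C` equals `-2`, and likewise for `D`. -/
theorem arrangedC2_core_row_products (m n h : ℕ) (hm : 1 ≤ m) (hh : 1 ≤ h)
    (hn : n = 2 * h + 2)
    (H : Matrix (Fin n) (Fin n) ℂ)
    (hroots : ∀ i j, H i j ^ m = 1)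
    (hortho : H * H.conjTranspose = (n : ℂ) • 1)
    (hrow1 : ∀ j, H ⟨0, by omega⟩ j = 1)
    (hcol1 : ∀ i, H i ⟨0, by omega⟩ = 1)
    (harrRow : ∀ j : Fin n, H ⟨1, by omega⟩ j =
      if (j : ℕ) = 0 then 1 else if (j : ℕ) = 1 then -1
      else if (j : ℕ) < h + 2 then 1 else -1)
    (harrCol : ∀ i : Fin n, H i ⟨1, by omega⟩ =
      if (i : ℕ) = 0 then 1 else if (i : ℕ) = 1 then -1
      else if (i : ℕ) < h + 2 then 1 else -1)
    (C D : Fin h → Fin (2 * h) → ℂ)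
    (hC : ∀ (i : Fin h) (j : Fin (2 * h)),
      C i j = H ⟨(i : ℕ) + 2, by omega⟩ ⟨(j : ℕ) + 2, by omega⟩)
    (hD : ∀ (i : Fin h) (j : Fin (2 * h)),
      D i j = H ⟨(i : ℕ) + 2 + h, by omega⟩ ⟨(j : ℕ) + 2, by omega⟩) :
    (∀ i i' : Fin h, i ≠ i' →
      ∑ j : Fin (2 * h), C i j * (starRingEnd ℂ) (C i' j) = -2) ∧
    (∀ i i' : Fin h, i ≠ i' →
      ∑ j : Fin (2 * h), D i j * (starRingEnd ℂ) (D i' j) = -2) := by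
  subst hn
  have key : ∀ a b : Fin (2 * h + 2), a ≠ b →
      H a ⟨1, by omega⟩ * (starRingEnd ℂ) (H b ⟨1, by omega⟩) = 1 →
      ∑ j : Fin (2 * h), H a ⟨(j : ℕ) + 2, by omega⟩ *
        (starRingEnd ℂ) (H b ⟨(j : ℕ) + 2, by omega⟩) = -2 := by
    intro a b hab h1
    have e := congrFun (congrFun hortho a) b
    simp only [Matrix.mul_apply, Matrix.conjTranspose_apply, Matrix.smul_apply,
      Matrix.one_apply_ne hab, smul_zero] at e
    rw [Fin.sum_univ_succ, Fin.sum_univ_succ] at e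
    have h0 : H a 0 * star (H b 0) = 1 := by
      have ha := hcol1 a
      have hb := hcol1 b
      change H a 0 = 1 at ha
      change H b 0 = 1 at hb
      rw [ha, hb]; simp
    have e' : (1 : ℂ) + (1 + ∑ j : Fin (2 * h), H a ⟨(j : ℕ) + 2, by omega⟩ *
        (starRingEnd ℂ) (H b ⟨(j : ℕ) + 2, by omega⟩)) = 0 := by
      rw [← e, h0]
      congr 2
      exact h1.symm
    linear_combination e'
  constructor
  · intro i i' hne
    simp only [hC]
    apply key
    · intro hc
      apply hne
      simp only [Fin.mk.injEq] at hc
      ext; omega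
    · rw [harrCol, harrCol]
      simp
  · intro i i' hne
    simp only [hD]
    apply key
    · intro hc
      apply hne
      simp only [Fin.mk.injEq] at hc
      ext; omega
    · rw [harrCol, harrCol]
      have q : ∀ k : ℕ, ¬ (k + 2 + h = 0) ∧ ¬ (k + 2 + h = 1) ∧ ¬ (k + 2 + h < h + 2) := by
        intro k; omega
      simp only [(q _).1, (q _).2.1, (q _).2.2, if_false]
      simp
end

section
/- Let n ≥ 4 be even and m ≥ 1. Let H be a normalized Butson matrix BH(m,n) in arranged C2 form, and let C and D be the associated (n−2)/2 × (n−2) matrices. Then for all row indices i of C and i′ of D, the inner product of row i of C and row i′ of D equals 0, i.e. Σ_{j=1}^{n−2} C_{i j}·conj(D_{i′ j}) = 0. -/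
/-- Lemma 2, part 2.  Let `n = 2h+2 ≥ 4` be even and let `H` be a
normalized Butson matrix `BH(m,n)` in arranged C2 form (second row and second column
equal to `w = (1, -1, 1,…,1, -1,…,-1)`), with `C`, `D` the top and bottom halves of
the lower-right `(n-2)×(n-2)` submatrix `T` of `H`.  Then every row of `C` is
orthogonal to every row of `D`. -/
theorem arrangedC2_C_D_orthogonal (m n h : ℕ) (hm : 1 ≤ m) (hh : 1 ≤ h)
    (hn : n = 2 * h + 2)
    (H : Matrix (Fin n) (Fin n) ℂ)
    (hroots : ∀ i j, H i j ^ m = 1)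
    (hortho : H * H.conjTranspose = (n : ℂ) • 1)
    (hrow1 : ∀ j, H ⟨0, by omega⟩ j = 1)
    (hcol1 : ∀ i, H i ⟨0, by omega⟩ = 1)
    (harrRow : ∀ j : Fin n, H ⟨1, by omega⟩ j =
      if (j : ℕ) = 0 then 1 else if (j : ℕ) = 1 then -1
      else if (j : ℕ) < h + 2 then 1 else -1)
    (harrCol : ∀ i : Fin n, H i ⟨1, by omega⟩ =
      if (i : ℕ) = 0 then 1 else if (i : ℕ) = 1 then -1
      else if (i : ℕ) < h + 2 then 1 else -1)
    (C D : Fin h → Fin (2 * h) → ℂ)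
    (hC : ∀ (i : Fin h) (j : Fin (2 * h)),
      C i j = H ⟨(i : ℕ) + 2, by omega⟩ ⟨(j : ℕ) + 2, by omega⟩)
    (hD : ∀ (i : Fin h) (j : Fin (2 * h)),
      D i j = H ⟨(i : ℕ) + 2 + h, by omega⟩ ⟨(j : ℕ) + 2, by omega⟩) :
    ∀ (i i' : Fin h), ∑ j : Fin (2 * h), C i j * (starRingEnd ℂ) (D i' j) = 0 := by
  intro i i'
  subst hn
  have key := congrFun (congrFun hortho ⟨(i : ℕ) + 2, by omega⟩) ⟨(i' : ℕ) + 2 + h, by omega⟩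
  have hne : (⟨(i : ℕ) + 2, by omega⟩ : Fin (2 * h + 2)) ≠ ⟨(i' : ℕ) + 2 + h, by omega⟩ := by
    intro e
    have e2 := congrArg Fin.val e
    simp only at e2
    omega
  rw [Matrix.mul_apply, Matrix.smul_apply, Matrix.one_apply_ne hne, smul_zero,
    Fin.sum_univ_succ, Fin.sum_univ_succ] at key
  simp only [Matrix.conjTranspose_apply] at key
  have a1 := hcol1 ⟨(i : ℕ) + 2, by omega⟩
  have a2 := hcol1 ⟨(i' : ℕ) + 2 + h, by omega⟩
  have b1 : H ⟨(i : ℕ) + 2, by omega⟩ ⟨1, by omega⟩ = 1 := by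
    rw [harrCol, if_neg (by simp), if_neg (by simp), if_pos (by simp)]
  have b2 : H ⟨(i' : ℕ) + 2 + h, by omega⟩ ⟨1, by omega⟩ = -1 := by
    rw [harrCol, if_neg (by simp), if_neg (by simp; omega), if_neg (by simp; omega)]
  change H _ ⟨0, _⟩ * star (H _ ⟨0, _⟩) + (H _ ⟨1, _⟩ * star (H _ ⟨1, _⟩) + _) = _ at key
  rw [a1, a2, b1, b2] at key
  simp only [star_one, star_neg, mul_one, one_mul, add_neg_cancel_left] at key
  rw [← key]
  refine Finset.sum_congr rfl fun j _ => ?_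
  rw [hC, hD]
  rfl
end

section
/- Let n ≥ 4 be even and m ≥ 1. Let H be a normalized Butson matrix BH(m,n) in arranged C2 form, and let C and D be the associated (n−2)/2 × (n−2) matrices. Then for every row index i of C, the sum of the first (n−2)/2 entries of row i of C equals −1 and the sum of the last (n−2)/2 entries of row i of C also equals −1: Σ_{j=1}^{(n−2)/2} C_{i j} = −1 and Σ_{j=(n−2)/2+1}^{n−2} C_{i j} = −1. -/
theorem sum_split_aux (h : ℕ) (f : Fin (2 * h + 2) → ℂ) :
    ∑ j, f j = f ⟨0, by omega⟩ + f ⟨1, by omega⟩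
      + ∑ j : Fin h, f ⟨(j : ℕ) + 2, by omega⟩
      + ∑ j : Fin h, f ⟨(j : ℕ) + h + 2, by omega⟩ := by
  let g : ℕ → ℂ := fun k => if hk : k < 2 * h + 2 then f ⟨k, hk⟩ else 0
  have hg : ∀ (k : ℕ) (hk : k < 2 * h + 2), f ⟨k, hk⟩ = g k := by
    intro k hk
    simp [g, hk]
  have h0 : ∑ j, f j = ∑ j : Fin (2 * h + 2), g j :=
    Finset.sum_congr rfl fun j _ => hg j j.2
  rw [h0]
  simp only [hg]
  rw [Fin.sum_univ_eq_sum_range (fun k => g k) (2 * h + 2),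
    Fin.sum_univ_eq_sum_range (fun k => g (k + 2)) h,
    Fin.sum_univ_eq_sum_range (fun k => g (k + h + 2)) h,
    Finset.sum_range_succ', Finset.sum_range_succ', two_mul, Finset.sum_range_add]
  have : ∀ k, g (h + k + 1 + 1) = g (k + h + 2) := fun k => by
    congr 1; omega
  simp only [this]
  simp only [add_assoc, Nat.reduceAdd, zero_add]
  ring

/-- Lemma 2, part 3.  Let `n = 2h+2 ≥ 4` be even and let `H` be a
normalized Butson matrix `BH(m,n)` in arranged C2 form (second row and second column
equal to `w = (1, -1, 1,…,1, -1,…,-1)`), with `C`, `D` the top and bottom halves of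
the lower-right `(n-2)×(n-2)` submatrix `T` of `H`.  Then in every row of `C` the
sum of the first `h = (n-2)/2` entries equals `-1` and the sum of the last `h`
entries equals `-1`. -/
theorem arrangedC2_C_half_sums (m n h : ℕ) (hm : 1 ≤ m) (hh : 1 ≤ h)
    (hn : n = 2 * h + 2)
    (H : Matrix (Fin n) (Fin n) ℂ)
    (hroots : ∀ i j, H i j ^ m = 1)
    (hortho : H * H.conjTranspose = (n : ℂ) • 1)
    (hrow1 : ∀ j, H ⟨0, by omega⟩ j = 1)
    (hcol1 : ∀ i, H i ⟨0, by omega⟩ = 1)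
    (harrRow : ∀ j : Fin n, H ⟨1, by omega⟩ j =
      if (j : ℕ) = 0 then 1 else if (j : ℕ) = 1 then -1
      else if (j : ℕ) < h + 2 then 1 else -1)
    (harrCol : ∀ i : Fin n, H i ⟨1, by omega⟩ =
      if (i : ℕ) = 0 then 1 else if (i : ℕ) = 1 then -1
      else if (i : ℕ) < h + 2 then 1 else -1)
    (C D : Fin h → Fin (2 * h) → ℂ)
    (hC : ∀ (i : Fin h) (j : Fin (2 * h)),
      C i j = H ⟨(i : ℕ) + 2, by omega⟩ ⟨(j : ℕ) + 2, by omega⟩)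
    (hD : ∀ (i : Fin h) (j : Fin (2 * h)),
      D i j = H ⟨(i : ℕ) + 2 + h, by omega⟩ ⟨(j : ℕ) + 2, by omega⟩) :
    ∀ i : Fin h,
      (∑ j : Fin h, C i ⟨(j : ℕ), by omega⟩ = -1) ∧
      (∑ j : Fin h, C i ⟨(j : ℕ) + h, by omega⟩ = -1) := by
  subst hn
  intro i
  have key : ∀ (r : Fin (2 * h + 2)), r ≠ ⟨(i : ℕ) + 2, by omega⟩ →
      ∑ j, H ⟨(i : ℕ) + 2, by omega⟩ j * star (H r j) = 0 := by
    intro r hr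
    have := congrFun (congrFun hortho ⟨(i : ℕ) + 2, by omega⟩) r
    simpa [Matrix.mul_apply, Matrix.one_apply, hr.symm] using this
  have e0 := key ⟨0, by omega⟩ (by simp [Fin.ext_iff])
  have e1 := key ⟨1, by omega⟩ (by simp [Fin.ext_iff])
  have hi : (i : ℕ) < h := i.2
  have c1 : H ⟨(i : ℕ) + 2, by omega⟩ ⟨1, by omega⟩ = 1 := by
    rw [harrCol]; simp [hi]
  rw [sum_split_aux] at e0 e1
  simp only [hrow1, hcol1, c1, harrRow] at e0 e1
  simp at e0 e1
  simp only [hC]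
  constructor
  · linear_combination (e0 + e1) / 2
  · linear_combination (e0 - e1) / 2
end

section
/- For every positive integer r, there exists a Butson matrix BH(2(2^r+1), 2^{r+1}(2^r+1)); that is, there exists a square complex matrix M of order N = 2^{r+1}(2^r+1) all of whose entries are 2(2^r+1)-th roots of unity and which satisfies M·M* = N·I_N. -/
/-- Existence of a Butson matrix `BH(m, n)`. -/
def ButsonExists (m n : ℕ) : Prop :=
  ∃ M : Matrix (Fin n) (Fin n) ℂ,
    (∀ i j, M i j ^ m = 1) ∧ M * M.conjTranspose = (n : ℂ) • 1

theorem ButsonExists.of_fintype {ι : Type} [Fintype ι] [DecidableEq ι] {m n : ℕ}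
    (e : ι ≃ Fin n) (M : Matrix ι ι ℂ) (h : ∀ i j, M i j ^ m = 1)
    (hM : M * M.conjTranspose = (n : ℂ) • 1) : ButsonExists m n := by
  refine ⟨M.submatrix e.symm e.symm, fun i j => h _ _, ?_⟩
  rw [Matrix.conjTranspose_submatrix, Matrix.submatrix_mul_equiv, hM]
  ext i j
  simp [Matrix.one_apply]

theorem ButsonExists.fourier (n : ℕ) [NeZero n] : ButsonExists n n := by
  refine ButsonExists.of_fintype (ZMod.finEquiv n).symm.toEquiv
    (Matrix.of fun i j : ZMod n => ZMod.stdAddChar (i * j)) (fun i j => ?_) ?_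
  · rw [Matrix.of_apply, ← AddChar.map_nsmul_eq_pow]
    simp
  · ext i k
    have h := AddChar.sum_mulShift (i - k) (ZMod.isPrimitive_stdAddChar n)
    simp only [Matrix.mul_apply, Matrix.conjTranspose_apply, Matrix.of_apply, Matrix.smul_apply,
      Matrix.one_apply]
    rw [ZMod.card] at h
    have h2 : ∀ j : ZMod n, (ZMod.stdAddChar (i * j) : ℂ) * star (ZMod.stdAddChar (k * j) : ℂ)
        = ZMod.stdAddChar (j * (i - k)) := by
      intro j
      rw [← starRingEnd_apply, ← AddChar.map_neg_eq_conj, ← AddChar.map_add_eq_mul]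
      congr 1
      ring
    simp_rw [h2, h, sub_eq_zero]
    split_ifs <;> simp

theorem ButsonExists.mul {m a b : ℕ} (ha : ButsonExists m a) (hb : ButsonExists m b) :
    ButsonExists m (a * b) := by
  obtain ⟨A, hA, hA'⟩ := ha
  obtain ⟨B, hB, hB'⟩ := hb
  refine ButsonExists.of_fintype finProdFinEquiv (Matrix.kroneckerMap (fun x y => x * y) A B) (fun i j => ?_) ?_
  · simp [mul_pow, hA, hB]
  · rw [Matrix.conjTranspose_kronecker, ← Matrix.mul_kronecker_mul, hA', hB',
      Matrix.smul_kronecker, Matrix.kronecker_smul, Matrix.one_kronecker_one, smul_smul]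
    push_cast
    rfl

theorem ButsonExists.mono {m m' n : ℕ} (h : ButsonExists m n) (hm : m ∣ m') :
    ButsonExists m' n := by
  obtain ⟨M, hM, hM'⟩ := h
  obtain ⟨c, rfl⟩ := hm
  exact ⟨M, fun i j => by rw [pow_mul, hM, one_pow], hM'⟩

theorem ButsonExists.two_pow (k : ℕ) : ButsonExists 2 (2 ^ k) := by
  induction k with
  | zero => exact (ButsonExists.fourier 1).mono (one_dvd 2)
  | succ k ih => exact ih.mul (ButsonExists.fourier 2)


/-- For every positive integer `r` there exists a Butson matrix
`BH(2(2^r+1), 2^(r+1)(2^r+1))`: a square complex matrix `M` of order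
`N = 2^(r+1)(2^r+1)` whose entries are `2(2^r+1)`-th roots of unity and which
satisfies `M·M* = N·I`. -/
theorem exists_butson_of_order_two_pow_succ_mul (r : ℕ) (hr : 0 < r) :
    ∃ M : Matrix (Fin (2 ^ (r + 1) * (2 ^ r + 1))) (Fin (2 ^ (r + 1) * (2 ^ r + 1))) ℂ,
      (∀ i j, M i j ^ (2 * (2 ^ r + 1)) = 1) ∧
      M * M.conjTranspose = ((2 ^ (r + 1) * (2 ^ r + 1) : ℕ) : ℂ) • 1 := by
  exact ((ButsonExists.two_pow (r + 1)).mono (dvd_mul_right _ _)).mul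
    ((ButsonExists.fourier (2 ^ r + 1)).mono (dvd_mul_left _ _))
end

section
/- Let n ≥ 6 be even, and set h = (n−2)/2. Let G and H be normalized Hadamard matrices of order n, where H is in arranged C2 form with associated h×(n−2) matrices C and D, and where G has two row indices p ≠ q with G_{q,j} = (−1)^{j−1}·G_{p,j} for all 1 ≤ j ≤ n; set x_j = G_{p,j}. Let L^(1),…,L^(n/2−2) be a complete set of LSESC of order n/2−1. Define the n(n/2−1) × n(n/2−1) matrix M as the vertical stack of B_0 and B, where: B_0 = G′ ⊗ J_{n/2−1}, with G′ the (n−2)×n matrix obtained from G by deleting rows p and q and J_{n/2−1} the 1×(n/2−1) all-ones row vector; and B has (n/2−1)(n−2) rows indexed by pairs (k,s) with 0 ≤ k ≤ n/2−2 and 1 ≤ s ≤ n−2, its columns forming n/2 consecutive blocks of width n−2 (blocks indexed j = 0,1,…,n/2−1). Set a(0,t,j) = t and a(k,t,j) = L^(k)_{t,j} for k ≥ 1. For s = t with 1 ≤ t ≤ h, the entry of row (k,s) in block 0 at position u is x_1·C_{k+1,u} if u ≤ h and x_2·C_{k+1,u} if u > h, and in block j ≥ 1 at position u it is x_{2j+1}·C_{a(k,t,j),u}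 if u ≤ h and x_{2j+2}·C_{a(k,t,j),u} if u > h. For s = h + t with 1 ≤ t ≤ h, the entries of row (k,s) are given by the same formulas with D in place of C. Then M is a Hadamard matrix of order n(n/2−1): all its entries lie in {1,−1} and M·Mᵀ = n(n/2−1)·I. -/
set_option maxHeartbeats 2000000

lemma aux_sum_pairs (m : ℕ) (f : Fin (2 * m) → ℝ) :
    ∑ j : Fin m, (f ⟨2 * (j : ℕ), by omega⟩ + f ⟨2 * (j : ℕ) + 1, by omega⟩) = ∑ c, f c := by
  induction m with
  | zero => simp
  | succ m ih =>
    rw [Fin.sum_univ_castSucc]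
    have h2 := ih (fun c => f ⟨c, by omega⟩)
    have h3 : ∑ c, f c = ∑ c : Fin (2 * m + 1 + 1), f ⟨c, by omega⟩ := rfl
    rw [h3, Fin.sum_univ_castSucc, Fin.sum_univ_castSucc]
    simp only [Fin.val_castSucc, Fin.val_last] at h2 ⊢
    rw [h2]
    ring

lemma aux_sum_half (h : ℕ) (A B : ℝ) :
    ∑ u : Fin (2 * h), (if (u : ℕ) < h then A else B) = h * (A + B) := by
  have h3 : ∑ u : Fin (2 * h), (if (u : ℕ) < h then A else B)
      = ∑ u ∈ Finset.range (h + h), (if (u : ℕ) < h then A else B) := by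
    rw [← two_mul]
    exact Fin.sum_univ_eq_sum_range (fun u => if u < h then A else B) (2 * h)
  rw [h3, Finset.sum_range_add]
  rw [Finset.sum_congr rfl (g := fun _ => A) (fun u hu => by simp at hu; simp [hu])]
  simp
  ring

/-- Corollary, two-input construction of Hadamard matrices of order
`n(n/2-1)`.  Let `n = 2h+2 ≥ 6` be even.  `G` and `H` are normalized Hadamard
matrices of order `n`; `H` is in arranged C2 form (second row and column equal to
`w = (1,-1,1,…,1,-1,…,-1)`), with `C`, `D` the top and bottom halves of the
lower-right `(n-2)×(n-2)` submatrix of `H`; `p ≠ q` are row indices of `G` with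
`G q j = (-1)^(j-1)·G p j`, and `x j = G p j`; `Ls` is a complete set of `n/2-2`
pairwise LSESC Latin squares of order `h = n/2-1`.  The matrix `M` is the vertical
stack of `B_0 = G' ⊗ J_{n/2-1}` (`G'` being `G` with rows `p, q` deleted) and `B`
(rows indexed by pairs `(k,s)`), whose columns form `n/2` blocks of width `n-2`
(block `j`, position `u` encoded as `(j,u)`): in block `j`, row `(k,s)` carries the
coefficient `x (2j)` on the first half (`u < h`) and `x (2j+1)` on the second half
(0-indexed), multiplying the entries of the row of `C` (if `s = t ≤ h`) or of `D`
(if `s = h+t`) indexed by `k+1` in block `0` and by `a(k,t,j)` in block `j ≥ 1`,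
where `a(0,t,j) = t` and `a(k,t,j) = L^(k)_{t,j}` for `k ≥ 1`.  Then `M` is a
Hadamard matrix of order `n(n/2-1)`: its entries lie in `{1,-1}` and
`M·Mᵀ = n(n/2-1)·I`. -/
theorem hadamard_half_scarpis_construction_two_inputs (n h : ℕ)
    (hh : 2 ≤ h) (hn : n = 2 * h + 2)
    (G H : Matrix (Fin n) (Fin n) ℝ)
    (hGpm : ∀ i j, G i j = 1 ∨ G i j = -1)
    (hGortho : G * G.transpose = (n : ℝ) • 1)
    (hGrow1 : ∀ j, G ⟨0, by omega⟩ j = 1)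
    (hGcol1 : ∀ i, G i ⟨0, by omega⟩ = 1)
    (hHpm : ∀ i j, H i j = 1 ∨ H i j = -1)
    (hHortho : H * H.transpose = (n : ℝ) • 1)
    (hHrow1 : ∀ j, H ⟨0, by omega⟩ j = 1)
    (hHcol1 : ∀ i, H i ⟨0, by omega⟩ = 1)
    (harrRow : ∀ j : Fin n, H ⟨1, by omega⟩ j =
      if (j : ℕ) = 0 then 1 else if (j : ℕ) = 1 then -1
      else if (j : ℕ) < h + 2 then 1 else -1)
    (harrCol : ∀ i : Fin n, H i ⟨1, by omega⟩ =
      if (i : ℕ) = 0 then 1 else if (i : ℕ) = 1 then -1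
      else if (i : ℕ) < h + 2 then 1 else -1)
    (C D : Fin h → Fin (2 * h) → ℝ)
    (hC : ∀ (i : Fin h) (j : Fin (2 * h)),
      C i j = H ⟨(i : ℕ) + 2, by omega⟩ ⟨(j : ℕ) + 2, by omega⟩)
    (hD : ∀ (i : Fin h) (j : Fin (2 * h)),
      D i j = H ⟨(i : ℕ) + 2 + h, by omega⟩ ⟨(j : ℕ) + 2, by omega⟩)
    -- the two rows of `G` witnessing condition C1
    (p q : Fin n) (hpq : p ≠ q)
    (hq : ∀ j : Fin n, G q j = (-1 : ℝ) ^ (j : ℕ) * G p j)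
    -- a complete set of LSESC of order `h = n/2 - 1`
    (Ls : Fin (h - 1) → Matrix (Fin h) (Fin h) (Fin h))
    (hLatinRow : ∀ k i, Function.Bijective (fun j => Ls k i j))
    (hLatinCol : ∀ k j, Function.Bijective (fun i => Ls k i j))
    (hLSESC : ∀ k k', k ≠ k' → ∀ i i', ∃! j, Ls k i j = Ls k' i' j)
    -- the row-indexing function `a`
    (a : Fin h → Fin h → Fin h → Fin h)
    (ha0 : ∀ t j, a ⟨0, by omega⟩ t j = t)
    (hak : ∀ (k : Fin h) (hk : (k : ℕ) ≠ 0) (t j : Fin h),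
      a k t j = Ls ⟨(k : ℕ) - 1, by omega⟩ t j)
    -- the matrix `M`: vertical stack of `B_0` and `B`
    (M : Matrix ({i : Fin n // i ≠ p ∧ i ≠ q} ⊕ Fin h × Fin (2 * h))
      (Fin (h + 1) × Fin (2 * h)) ℝ)
    (hB0 : ∀ (i : {i : Fin n // i ≠ p ∧ i ≠ q}) (j : Fin (h + 1)) (u : Fin (2 * h)),
      M (Sum.inl i) (j, u) =
        G i.1 ⟨if (u : ℕ) < h then 2 * (j : ℕ) else 2 * (j : ℕ) + 1, by split <;> omega⟩)
    (hBC : ∀ (k : Fin h) (s : Fin (2 * h)) (hs : (s : ℕ) < h)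
        (j : Fin (h + 1)) (u : Fin (2 * h)),
      M (Sum.inr (k, s)) (j, u) =
        G p ⟨if (u : ℕ) < h then 2 * (j : ℕ) else 2 * (j : ℕ) + 1, by split <;> omega⟩ *
          C (if hj : (j : ℕ) = 0 then k
             else a k ⟨(s : ℕ), hs⟩ ⟨(j : ℕ) - 1, by omega⟩) u)
    (hBD : ∀ (k : Fin h) (s : Fin (2 * h)) (hs : h ≤ (s : ℕ))
        (j : Fin (h + 1)) (u : Fin (2 * h)),
      M (Sum.inr (k, s)) (j, u) =
        G p ⟨if (u : ℕ) < h then 2 * (j : ℕ) else 2 * (j : ℕ) + 1, by split <;> omega⟩ *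
          D (if hj : (j : ℕ) = 0 then k
             else a k ⟨(s : ℕ) - h, by omega⟩ ⟨(j : ℕ) - 1, by omega⟩) u) :
    (∀ r c, M r c = 1 ∨ M r c = -1) ∧
      M * M.transpose = ((n * (n / 2 - 1) : ℕ) : ℝ) • 1 := by
  subst hn
  -- inner products of rows
  have hGin : ∀ i i', ∑ c, G i c * G i' c = if i = i' then ((2 * h + 2 : ℕ) : ℝ) else 0 := by
    intro i i'
    have := congrFun (congrFun hGortho i) i'
    simpa [Matrix.mul_apply, Matrix.one_apply] using this
  have hHin : ∀ i i', ∑ c, H i c * H i' c = if i = i' then ((2 * h + 2 : ℕ) : ℝ) else 0 := by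
    intro i i'
    have := congrFun (congrFun hHortho i) i'
    simpa [Matrix.mul_apply, Matrix.one_apply] using this
  have hsplit : ∀ f : Fin (2 * h + 2) → ℝ, ∑ c, f c = f ⟨0, by omega⟩ + f ⟨1, by omega⟩
      + ∑ u : Fin (2 * h), f ⟨(u : ℕ) + 2, by omega⟩ := by
    intro f
    rw [Fin.sum_univ_succ, Fin.sum_univ_succ, ← add_assoc]
    rfl
  obtain ⟨T, hT⟩ : ∃ T : Fin (2 * h) → Fin (2 * h) → ℝ,
      ∀ i j, T i j = H ⟨(i : ℕ) + 2, by omega⟩ ⟨(j : ℕ) + 2, by omega⟩ := ⟨_, fun _ _ => rfl⟩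
  obtain ⟨e, he⟩ : ∃ e : Fin (2 * h) → ℝ, ∀ s, e s = if (s : ℕ) < h then 1 else -1 :=
    ⟨_, fun _ => rfl⟩
  have he2 : ∀ s, e s * e s = 1 := by
    intro s; rw [he]; split <;> norm_num
  have hcol : ∀ r : Fin (2 * h), H ⟨(r : ℕ) + 2, by omega⟩ ⟨1, by omega⟩ = e r := by
    intro r
    rw [harrCol, he]
    simp
  have hrow : ∀ r : Fin (2 * h), H ⟨1, by omega⟩ ⟨(r : ℕ) + 2, by omega⟩ = e r := by
    intro r
    rw [harrRow, he]
    simp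
  have hTT : ∀ r r', ∑ u, T r u * T r' u =
      (if r = r' then ((2 * h + 2 : ℕ) : ℝ) else 0) - 1 - e r * e r' := by
    intro r r'
    have := hHin ⟨(r : ℕ) + 2, by omega⟩ ⟨(r' : ℕ) + 2, by omega⟩
    rw [hsplit] at this
    simp only [hHcol1, hcol, ← hT, Fin.mk.injEq, Nat.add_right_cancel_iff, ← Fin.ext_iff] at this
    linarith
  have hT0 : ∀ r, ∑ u, T r u = - 1 - e r := by
    intro r
    have := hHin ⟨(r : ℕ) + 2, by omega⟩ ⟨0, by omega⟩
    rw [hsplit] at this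
    simp only [hHrow1, hHcol1, hcol, ← hT, Fin.mk.injEq, mul_one] at this
    rw [if_neg (by omega)] at this
    linarith
  have hT1 : ∀ r, ∑ u, e u * T r u = - 1 + e r := by
    intro r
    have := hHin ⟨1, by omega⟩ ⟨(r : ℕ) + 2, by omega⟩
    rw [hsplit] at this
    simp only [hrow, hHcol1, hcol, ← hT, Fin.mk.injEq, mul_one] at this
    rw [if_neg (by omega), harrRow] at this
    simp at this
    linarith
  have hTh : ∀ (A B : ℝ) r, ∑ u : Fin (2 * h), (if (u : ℕ) < h then A else B) * T r u
      = - A - e r * B := by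
    intro A B r
    have h1 : ∀ u : Fin (2 * h), (if (u : ℕ) < h then A else B) * T r u
        = (A + B) / 2 * T r u + (A - B) / 2 * (e u * T r u) := by
      intro u; rw [he]; split <;> ring
    simp only [h1, Finset.sum_add_distrib, ← Finset.mul_sum, hT0, hT1]
    ring
  -- row index
  obtain ⟨t, ht⟩ : ∃ t : Fin (2 * h) → Fin h,
      ∀ s, (t s : ℕ) = if (s : ℕ) < h then (s : ℕ) else (s : ℕ) - h :=
    ⟨fun s => ⟨if (s : ℕ) < h then (s : ℕ) else (s : ℕ) - h, by split <;> omega⟩, fun _ => rfl⟩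
  obtain ⟨b, hb⟩ : ∃ b : Fin h → Fin h → Fin (h + 1) → Fin h, ∀ k v j, b k v j =
      if hj : (j : ℕ) = 0 then k else a k v ⟨(j : ℕ) - 1, by omega⟩ := ⟨_, fun _ _ _ => rfl⟩
  obtain ⟨rr, hrr⟩ : ∃ rr : Fin h → Fin (2 * h) → Fin (h + 1) → Fin (2 * h), ∀ k s j,
      (rr k s j : ℕ) = (b k (t s) j : ℕ) + if (s : ℕ) < h then 0 else h :=
    ⟨fun k s j => ⟨(b k (t s) j : ℕ) + if (s : ℕ) < h then 0 else h, by split <;> omega⟩,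
      fun _ _ _ => rfl⟩
  have her : ∀ k s j, e (rr k s j) = e s := by
    intro k s j
    rw [he, he, hrr]
    have := (b k (t s) j).2
    by_cases hs : (s : ℕ) < h
    · simp [hs]
    · simp [hs]
  obtain ⟨col, hcl⟩ : ∃ col : Fin (h + 1) → Fin (2 * h) → Fin (2 * h + 2), ∀ j u, col j u =
      ⟨if (u : ℕ) < h then 2 * (j : ℕ) else 2 * (j : ℕ) + 1, by split <;> omega⟩ :=
    ⟨_, fun _ _ => rfl⟩
  have hcolsum : ∀ (f : Fin (2 * h + 2) → ℝ) j u, f (col j u) =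
      if (u : ℕ) < h then f ⟨2 * (j : ℕ), by omega⟩ else f ⟨2 * (j : ℕ) + 1, by omega⟩ := by
    intro f j u
    rw [hcl]
    by_cases hu : (u : ℕ) < h
    · simp [hu]
    · simp [hu]
  have hMl : ∀ i j u, M (Sum.inl i) (j, u) = G i.1 (col j u) := by
    intro i j u
    rw [hB0, hcl]
  have hMr : ∀ k s j u, M (Sum.inr (k, s)) (j, u) = G p (col j u) * T (rr k s j) u := by
    intro k s j u
    by_cases hs : (s : ℕ) < h
    · rw [hBC k s hs, hcl, hC, hT]
      have h1 : t s = ⟨s, hs⟩ := Fin.ext (by rw [ht, if_pos hs])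
      have h2 := hrr k s j
      rw [if_pos hs, hb, h1, add_zero] at h2
      congr 3
      rw [h2]
    · rw [hBD k s (by omega), hcl, hD, hT]
      have h1 : t s = ⟨s - h, by omega⟩ := Fin.ext (by rw [ht, if_neg hs])
      have h2 := hrr k s j
      rw [if_neg hs, hb, h1] at h2
      congr 3
      rw [h2]
      ring
  have hpair : ∀ f : Fin (2 * h + 2) → ℝ, ∑ j : Fin (h + 1),
      (f ⟨2 * (j : ℕ), by omega⟩ + f ⟨2 * (j : ℕ) + 1, by omega⟩) = ∑ c, f c :=
    fun f => aux_sum_pairs (h + 1) f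
  have hll : ∀ i i' : {i : Fin (2 * h + 2) // i ≠ p ∧ i ≠ q},
      ∑ c, M (Sum.inl i) c * M (Sum.inl i') c =
        if i = i' then ((2 * h + 2 : ℕ) : ℝ) * h else 0 := by
    intro i i'
    rw [Fintype.sum_prod_type]
    simp only [hMl]
    have h1 : ∀ j u, G i.1 (col j u) * G i'.1 (col j u) = _ :=
      hcolsum (fun c => G i.1 c * G i'.1 c)
    simp only [h1, aux_sum_half, ← Finset.mul_sum]
    rw [hpair (fun c => G i.1 c * G i'.1 c), hGin]
    simp only [← Subtype.ext_iff]
    split <;> ring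
  have hlr : ∀ (i : {i : Fin (2 * h + 2) // i ≠ p ∧ i ≠ q}) k s,
      ∑ c, M (Sum.inl i) c * M (Sum.inr (k, s)) c = 0 := by
    intro i k s
    rw [Fintype.sum_prod_type]
    simp only [hMl, hMr, ← mul_assoc]
    have h1 : ∀ j u, G i.1 (col j u) * G p (col j u) = _ :=
      hcolsum (fun c => G i.1 c * G p c)
    simp only [h1, hTh, her]
    have hip : ∑ c, G i.1 c * G p c = 0 := by rw [hGin, if_neg i.2.1]
    have hiq : ∑ c, G i.1 c * G q c = 0 := by rw [hGin, if_neg i.2.2]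
    rw [← hpair] at hip hiq
    simp only [hq, pow_succ, pow_mul] at hiq
    norm_num at hiq
    rw [he]
    split
    · rw [← neg_eq_zero, ← Finset.sum_neg_distrib, ← hip]
      exact Finset.sum_congr rfl fun j _ => by ring
    · rw [← neg_eq_zero, ← Finset.sum_neg_distrib, ← hiq]
      exact Finset.sum_congr rfl fun j _ => by ring
  have hG2 : ∀ i c, G i c * G i c = 1 := by
    intro i c
    rcases hGpm i c with h1 | h1 <;> rw [h1] <;> norm_num
  have hainj : ∀ k v v' j, a k v j = a k v' j → v = v' := by
    intro k v v' j hv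
    by_cases hk : (k : ℕ) = 0
    · have : k = ⟨0, by omega⟩ := Fin.ext hk
      rw [this, ha0, ha0] at hv
      exact hv
    · rw [hak k hk, hak k hk] at hv
      exact (hLatinCol _ j).1 hv
  have hauniq : ∀ k k' v v', k ≠ k' → ∃! j, a k v j = a k' v' j := by
    intro k k' v v' hkk
    by_cases hk : (k : ℕ) = 0
    · have hk' : (k' : ℕ) ≠ 0 := fun h0 => hkk (Fin.ext (by omega))
      have h0 : k = ⟨0, by omega⟩ := Fin.ext hk
      have hka : ∀ v j, a k v j = v := by intro v j; rw [h0, ha0]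
      simp only [hka, hak k' hk']
      simpa only [eq_comm] using (hLatinRow ⟨(k' : ℕ) - 1, by omega⟩ v').existsUnique v
    · by_cases hk' : (k' : ℕ) = 0
      · have h0 : k' = ⟨0, by omega⟩ := Fin.ext hk'
        have hka : ∀ v j, a k' v j = v := by intro v j; rw [h0, ha0]
        simp only [hka, hak k hk]
        exact (hLatinRow ⟨(k : ℕ) - 1, by omega⟩ v).existsUnique v'
      · simp only [hak k hk, hak k' hk']
        apply hLSESC
        intro h0
        rw [Fin.mk.injEq] at h0
        exact hkk (Fin.ext (by omega))
  have hcount : ∀ k v k' v', ∑ j : Fin (h + 1), (if b k v j = b k' v' j then (1 : ℝ) else 0)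
      = if k = k' ∧ v = v' then (h : ℝ) + 1 else 1 := by
    intro k v k' v'
    by_cases hkv : k = k' ∧ v = v'
    · obtain ⟨rfl, rfl⟩ := hkv
      simp
    · rw [if_neg hkv, Fin.sum_univ_succ]
      have hb0 : ∀ k v, b k v 0 = k := by intro k v; rw [hb]; simp
      have hbs : ∀ k v (j : Fin h), b k v j.succ = a k v j := by intro k v j; rw [hb]; simp
      simp only [hb0, hbs]
      by_cases hkk : k = k'
      · subst hkk
        have hvv : v ≠ v' := fun h0 => hkv ⟨rfl, h0⟩
        rw [Finset.sum_eq_zero]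
        · simp
        · intro j _
          rw [if_neg]
          exact fun h0 => hvv (hainj _ _ _ _ h0)
      · obtain ⟨j0, hj0, hj1⟩ := hauniq k k' v v' hkk
        rw [if_neg hkk, Finset.sum_eq_single j0]
        · simp [hj0]
        · intro j _ hj
          rw [if_neg]
          exact fun h0 => hj (hj1 j h0)
        · simp
  have hrrM : ∀ k s k' s', ∑ c, M (Sum.inr (k, s)) c * M (Sum.inr (k', s')) c =
      if (k, s) = (k', s') then ((2 * h + 2 : ℕ) : ℝ) * h else 0 := by
    intro k s k' s'
    rw [Fintype.sum_prod_type]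
    simp only [hMr]
    have h1 : ∀ j u, G p (col j u) * T (rr k s j) u * (G p (col j u) * T (rr k' s' j) u)
        = T (rr k s j) u * T (rr k' s' j) u := by
      intro j u
      linear_combination (T (rr k s j) u * T (rr k' s' j) u) * hG2 p (col j u)
    simp only [h1, hTT, her]
    by_cases hss : ((s : ℕ) < h ↔ (s' : ℕ) < h)
    · have hee : e s' = e s := by rw [he, he]; simp only [hss]
      have h2 : ∀ j, (rr k s j = rr k' s' j) ↔ b k (t s) j = b k' (t s') j := by
        intro j
        rw [Fin.ext_iff, Fin.ext_iff, hrr, hrr]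
        simp only [hss]
        omega
      have h3 : ((k, s) = (k', s')) ↔ (k = k' ∧ t s = t s') := by
        rw [Prod.mk.injEq]
        have : s = s' ↔ t s = t s' := by
          rw [Fin.ext_iff, Fin.ext_iff, ht, ht]
          split_ifs <;> omega
        rw [this]
      simp only [h2, h3, hee, he2]
      have h4 := hcount k (t s) k' (t s')
      have h5 : ∀ j, (if b k (t s) j = b k' (t s') j then ((2 * h + 2 : ℕ) : ℝ) else 0) - 1 - 1
          = ((2 * h + 2 : ℕ) : ℝ) * (if b k (t s) j = b k' (t s') j then (1 : ℝ) else 0) - 2 := by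
        intro j; split <;> ring
      simp only [h5, Finset.sum_sub_distrib, ← Finset.mul_sum, h4]
      simp
      split <;> ring
    · have hee : e s * e s' = -1 := by
        rw [he, he]
        by_cases h1 : (s : ℕ) < h
        · have h2 : ¬ (s' : ℕ) < h := fun h2 => hss (iff_of_true h1 h2)
          rw [if_pos h1, if_neg h2]; norm_num
        · have h2 : (s' : ℕ) < h := by
            by_contra h2
            exact hss (iff_of_false h1 h2)
          rw [if_neg h1, if_pos h2]; norm_num
      have h2 : ∀ j, rr k s j ≠ rr k' s' j := by
        intro j h0
        have h1 := her k s j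
        rw [h0, her] at h1
        rw [h1, he2] at hee
        norm_num at hee
      have h3 : (k, s) ≠ (k', s') := by
        intro h0
        rw [Prod.mk.injEq] at h0
        exact hss (by rw [h0.2])
      simp [h2, h3, hee]
  refine ⟨?_, ?_⟩
  · rintro (i | ⟨k, s⟩) ⟨j, u⟩
    · rw [hMl]; exact hGpm _ _
    · rw [hMr, hT]
      rcases hGpm p (col j u) with h1 | h1 <;>
        rcases hHpm ⟨(rr k s j : ℕ) + 2, by omega⟩ ⟨(u : ℕ) + 2, by omega⟩ with h2 | h2 <;>
        rw [h1, h2] <;> norm_num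
  · have hN : (((2 * h + 2) * ((2 * h + 2) / 2 - 1) : ℕ) : ℝ) = ((2 * h + 2 : ℕ) : ℝ) * h := by
      have : (2 * h + 2) / 2 - 1 = h := by omega
      rw [this, Nat.cast_mul]
    rw [hN]
    ext r r'
    rw [Matrix.mul_apply, Matrix.smul_apply, Matrix.one_apply]
    simp only [Matrix.transpose_apply, smul_eq_mul, mul_ite, mul_one, mul_zero]
    rcases r with i | ⟨k, s⟩ <;> rcases r' with i' | ⟨k', s'⟩
    · rw [hll]; simp only [Sum.inl.injEq]
    · rw [hlr]; simp
    · simp only [mul_comm (M (Sum.inr (k, s)) _)]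
      rw [hlr]; simp
    · rw [hrrM]; simp only [Sum.inr.injEq]
end

section
/- For every positive integer n, the maximum cardinality N′(n) of a family of pairwise LSESC Latin squares of order n equals the maximum cardinality N(n) of a family of pairwise orthogonal Latin squares (MOLS) of order n: N′(n) = N(n). -/
/-- `L` is a Latin square of order `n` (rows, columns and symbols indexed by `Fin n`):
every row and every column is a bijection onto the symbol set. -/
def IsLatinSquare {n : ℕ} (L : Matrix (Fin n) (Fin n) (Fin n)) : Prop :=
  (∀ i, Function.Bijective (fun j => L i j)) ∧ (∀ j, Function.Bijective (fun i => L i j))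

/-- Two Latin squares are LSESC (eligible for Scarpis construction): for every pair
of row indices `i, i'` there is a unique column `j` with `L i j = L' i' j`. -/
def AreLSESC {n : ℕ} (L L' : Matrix (Fin n) (Fin n) (Fin n)) : Prop :=
  ∀ i i' : Fin n, ∃! j : Fin n, L i j = L' i' j

/-- Two Latin squares are orthogonal: every pair of symbols occurs in exactly one cell. -/
def AreOrthogonal {n : ℕ} (M M' : Matrix (Fin n) (Fin n) (Fin n)) : Prop :=
  ∀ a b : Fin n, ∃! rc : Fin n × Fin n, M rc.1 rc.2 = a ∧ M' rc.1 rc.2 = b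

open Classical in
/-- The conjugate of a square exchanging the roles of rows and symbols. -/
noncomputable def conjSq {n : ℕ} (L : Matrix (Fin n) (Fin n) (Fin n)) :
    Matrix (Fin n) (Fin n) (Fin n) :=
  fun s j => if h : ∃ i, L i j = s then h.choose else s

theorem conjSq_iff {n : ℕ} {L : Matrix (Fin n) (Fin n) (Fin n)} (hL : IsLatinSquare L)
    (s j i : Fin n) : conjSq L s j = i ↔ L i j = s := by
  have h : ∃ i, L i j = s := (hL.2 j).2 s
  have e : conjSq L s j = h.choose := by
    unfold conjSq
    rw [dif_pos h]
  have hs := h.choose_spec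
  rw [e]
  constructor
  · intro hi
    rw [← hi]
    exact hs
  · intro hi
    exact (hL.2 j).1 (hs.trans hi.symm)

theorem conjSq_latin {n : ℕ} {L : Matrix (Fin n) (Fin n) (Fin n)} (hL : IsLatinSquare L) :
    IsLatinSquare (conjSq L) := by
  constructor
  · intro s
    refine Finite.injective_iff_bijective.mp ?_
    intro j j' h
    have h1 := (conjSq_iff hL s j _).1 h
    have h2 := (conjSq_iff hL s j' _).1 rfl
    exact (hL.1 _).1 (h1.trans h2.symm)
  · intro j
    refine Finite.injective_iff_bijective.mp ?_
    intro s s' h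
    have h1 := (conjSq_iff hL s j _).1 h
    have h2 := (conjSq_iff hL s' j _).1 rfl
    exact h1.symm.trans h2

theorem conjSq_inj {n : ℕ} {L L' : Matrix (Fin n) (Fin n) (Fin n)} (hL : IsLatinSquare L)
    (hL' : IsLatinSquare L') (h : conjSq L = conjSq L') : L = L' := by
  funext i j
  have h1 := (conjSq_iff hL (L i j) j i).2 rfl
  rw [h] at h1
  exact ((conjSq_iff hL' _ j i).1 h1).symm

theorem conjSq_orth {n : ℕ} {L L' : Matrix (Fin n) (Fin n) (Fin n)} (hL : IsLatinSquare L)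
    (hL' : IsLatinSquare L') (h : AreLSESC L L') : AreOrthogonal (conjSq L) (conjSq L') := by
  intro a b
  obtain ⟨j, hj, hu⟩ := h a b
  refine ⟨(L a j, j), ⟨(conjSq_iff hL _ _ _).2 rfl, (conjSq_iff hL' _ _ _).2 hj.symm⟩, ?_⟩
  rintro ⟨s, k⟩ ⟨h1, h2⟩
  have h1 := (conjSq_iff hL _ _ _).1 h1
  have h2 := (conjSq_iff hL' _ _ _).1 h2
  have hk : k = j := hu k (h1.trans h2.symm)
  subst hk
  exact Prod.ext h1.symm rfl

theorem conjSq_lsesc {n : ℕ} {L L' : Matrix (Fin n) (Fin n) (Fin n)} (hL : IsLatinSquare L)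
    (hL' : IsLatinSquare L') (h : AreOrthogonal L L') : AreLSESC (conjSq L) (conjSq L') := by
  intro a b
  obtain ⟨⟨r, j⟩, ⟨h1, h2⟩, hu⟩ := h a b
  refine ⟨j, ((conjSq_iff hL _ _ _).2 h1).trans ((conjSq_iff hL' _ _ _).2 h2).symm, ?_⟩
  intro k hk
  have h3 := (conjSq_iff hL _ _ _).1 hk
  have h4 := (conjSq_iff hL' b k _).1 rfl
  exact congrArg Prod.snd (hu (_, k) ⟨h3, h4⟩)

theorem conjSq_transfer {n : ℕ}
    {P Q : Matrix (Fin n) (Fin n) (Fin n) → Matrix (Fin n) (Fin n) (Fin n) → Prop}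
    (hPQ : ∀ L L', IsLatinSquare L → IsLatinSquare L' → P L L' → Q (conjSq L) (conjSq L'))
    {k : ℕ} (hk : ∃ S : Finset (Matrix (Fin n) (Fin n) (Fin n)), S.card = k ∧
        (∀ L ∈ S, IsLatinSquare L) ∧ ∀ L ∈ S, ∀ L' ∈ S, L ≠ L' → P L L') :
    ∃ S : Finset (Matrix (Fin n) (Fin n) (Fin n)), S.card = k ∧
        (∀ L ∈ S, IsLatinSquare L) ∧ ∀ L ∈ S, ∀ L' ∈ S, L ≠ L' → Q L L' := by
  classical
  obtain ⟨S, hc, hl, hp⟩ := hk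
  refine ⟨S.image conjSq, ?_, ?_, ?_⟩
  · rw [Finset.card_image_of_injOn, hc]
    intro L h L' h' e
    exact conjSq_inj (hl L h) (hl L' h') e
  · intro M hM
    obtain ⟨L, h, rfl⟩ := Finset.mem_image.1 hM
    exact conjSq_latin (hl L h)
  · intro M hM M' hM' hne
    obtain ⟨L, h, rfl⟩ := Finset.mem_image.1 hM
    obtain ⟨L', h', rfl⟩ := Finset.mem_image.1 hM'
    exact hPQ L L' (hl L h) (hl L' h') (hp L h L' h' fun e => hne (congrArg conjSq e))

/-- the maximum cardinality `N'(n)` of a family of pairwise LSESC Latin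
squares of order `n` equals the maximum cardinality `N(n)` of a family of mutually
orthogonal Latin squares of order `n`. -/
theorem max_lsesc_eq_max_mols (n : ℕ) (hn : 0 < n) :
    sSup {k : ℕ | ∃ S : Finset (Matrix (Fin n) (Fin n) (Fin n)), S.card = k ∧
        (∀ L ∈ S, IsLatinSquare L) ∧
        ∀ L ∈ S, ∀ L' ∈ S, L ≠ L' → AreLSESC L L'} =
    sSup {k : ℕ | ∃ S : Finset (Matrix (Fin n) (Fin n) (Fin n)), S.card = k ∧
        (∀ L ∈ S, IsLatinSquare L) ∧
        ∀ L ∈ S, ∀ L' ∈ S, L ≠ L' → AreOrthogonal L L'} := by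
  congr 1
  ext k
  exact ⟨conjSq_transfer fun _ _ h h' => conjSq_orth h h',
    conjSq_transfer fun _ _ h h' => conjSq_lsesc h h'⟩
end
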